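/- Let Z be a topological space, let A : Z → Matrix (Fin p) (Fin n) ℂ be a continuous matrix-valued map, and suppose there is an integer i ≥ 0 with dim_ℂ ker A(z) = i for every z ∈ Z. Let L = {(z,v) ∈ Z × ℂ^n : A(z)v = 0} with the subspace topology and projection π : L → Z. Then π is a locally trivial ℂ-vector bundle of rank i: every z₀ ∈ Z has an open neighbourhood V and a homeomorphism φ : V × ℂ^i → π^{-1}(V) such that π(φ(z,w)) = z for all (z,w) ∈ V × ℂ^i and such that for each z ∈ V the map w ↦ φ(z,w) is a ℂ-linear isomorphism from ℂ^i onto ker A(z). -/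

import Mathlib

/-- There are linear maps with `S T + s q = 1` where `q` takes values in `ℂ^i`, `i = dim ker T`. -/
theorem kernel_aux {p n i : ℕ} (T : (Fin n → ℂ) →ₗ[ℂ] (Fin p → ℂ))
    (h : Module.finrank ℂ (LinearMap.ker T) = i) :
    ∃ (S : (Fin p → ℂ) →ₗ[ℂ] (Fin n → ℂ)) (s : (Fin i → ℂ) →ₗ[ℂ] (Fin n → ℂ))
      (q : (Fin n → ℂ) →ₗ[ℂ] (Fin i → ℂ)), ∀ v, S (T v) + s (q v) = v := by
  obtain ⟨P, hP⟩ := LinearMap.exists_leftInverse_of_injective (LinearMap.ker T).subtype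
    (LinearMap.ker T).ker_subtype
  let e : LinearMap.ker T ≃ₗ[ℂ] (Fin i → ℂ) :=
    LinearEquiv.ofFinrankEq _ _ (by simp [h])
  have hle : LinearMap.ker T ≤ LinearMap.ker
      (LinearMap.id - (LinearMap.ker T).subtype ∘ₗ P : (Fin n → ℂ) →ₗ[ℂ] (Fin n → ℂ)) := by
    intro v hv
    have := LinearMap.congr_fun hP ⟨v, hv⟩
    simp only [LinearMap.comp_apply, Submodule.subtype_apply, LinearMap.id_apply] at this
    simp [this]
  obtain ⟨S, hS⟩ := LinearMap.exists_extend
    (((LinearMap.ker T).liftQ _ hle) ∘ₗ T.quotKerEquivRange.symm.toLinearMap)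
  refine ⟨S, (LinearMap.ker T).subtype ∘ₗ e.symm.toLinearMap, e.toLinearMap ∘ₗ P, fun v => ?_⟩
  have h1 := LinearMap.congr_fun hS ⟨T v, LinearMap.mem_range_self T v⟩
  have h2 : T.quotKerEquivRange.symm ⟨T v, LinearMap.mem_range_self T v⟩
      = (LinearMap.ker T).mkQ v := LinearMap.quotKerEquivRange_symm_apply_image T v _
  simp only [LinearMap.comp_apply, Submodule.subtype_apply, LinearEquiv.coe_coe] at h1
  rw [h2] at h1
  simp only [Submodule.mkQ_apply, Submodule.liftQ_apply] at h1
  rw [h1]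
  simp

/-- If a continuous family of matrices `A : Z → M_{p,n}(ℂ)` has kernel of constant dimension `i`,
then the kernel pseudo vector bundle `L = {(z,v) | A(z)v = 0}` is a locally trivial ℂ-vector
bundle of rank `i` over `Z`. -/
theorem kernel_constant_rank_locally_trivial
    {p n : ℕ} {Z : Type*} [TopologicalSpace Z]
    (A : Z → Matrix (Fin p) (Fin n) ℂ) (hA : Continuous A)
    (i : ℕ) (hdim : ∀ z : Z, Module.finrank ℂ (LinearMap.ker (A z).mulVecLin) = i)
    (L : Set (Z × (Fin n → ℂ)))
    (hL : L = {q : Z × (Fin n → ℂ) | (A q.1).mulVec q.2 = 0}) :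
    ∀ z₀ : Z, ∃ V : Set Z, IsOpen V ∧ z₀ ∈ V ∧
      ∃ φ : (V × (Fin i → ℂ)) ≃ₜ {q ∈ L | q.1 ∈ V},
        (∀ (z : V) (w : Fin i → ℂ), ((φ (z, w) : Z × (Fin n → ℂ))).1 = (z : Z)) ∧
        ∀ z : V,
          IsLinearMap ℂ (fun w : Fin i → ℂ => ((φ (z, w) : Z × (Fin n → ℂ))).2) ∧
          Function.Injective (fun w : Fin i → ℂ => ((φ (z, w) : Z × (Fin n → ℂ))).2) ∧
          ∀ v : Fin n → ℂ, (A (z : Z)).mulVec v = 0 →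
            ∃ w : Fin i → ℂ, ((φ (z, w) : Z × (Fin n → ℂ))).2 = v := by
  subst hL
  intro z₀
  obtain ⟨S, s, q, hSq⟩ := kernel_aux (A z₀).mulVecLin (hdim z₀)
  let M : Z → Matrix (Fin n) (Fin n) ℂ := fun z =>
    LinearMap.toMatrix' S * A z + LinearMap.toMatrix' (s ∘ₗ q)
  have hMv : ∀ z v, (M z).mulVec v = S ((A z).mulVec v) + s (q v) := by
    intro z v
    simp only [M, Matrix.add_mulVec, ← Matrix.mulVec_mulVec, LinearMap.toMatrix'_mulVec,
      LinearMap.comp_apply]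
  have hM : Continuous M := by fun_prop
  have hM0 : M z₀ = 1 := by
    apply Matrix.mulVec_injective
    funext v
    rw [hMv, Matrix.one_mulVec]
    exact hSq v
  let N : Z → Matrix (Fin n) (Fin n) ℂ := fun z => (M z).det⁻¹ • (M z).adjugate
  have hNM : ∀ z, (M z).det ≠ 0 → ∀ v, (N z).mulVec ((M z).mulVec v) = v := by
    intro z hz v
    rw [Matrix.mulVec_mulVec]
    simp only [N, Matrix.smul_mul, Matrix.adjugate_mul, smul_smul]
    rw [inv_mul_cancel₀ hz, one_smul, Matrix.one_mulVec]
  have hker : ∀ z v, (A z).mulVec v = 0 → (M z).mulVec v = s (q v) := by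
    intro z v hv
    rw [hMv, hv, map_zero, zero_add]
  have hleft : ∀ z, (M z).det ≠ 0 → ∀ v, (A z).mulVec v = 0 → (N z).mulVec (s (q v)) = v := by
    intro z hz v hv
    rw [← hker z v hv, hNM z hz]
  have hsurj : ∀ z, (M z).det ≠ 0 → ∀ w, ∃ v, (A z).mulVec v = 0 ∧ q v = w := by
    intro z hz w
    have hinj : Function.Injective (q ∘ₗ (LinearMap.ker (A z).mulVecLin).subtype) := by
      intro a b hab
      simp only [LinearMap.comp_apply, Submodule.subtype_apply] at hab
      apply Subtype.ext
      rw [← hleft z hz a a.2, ← hleft z hz b b.2, hab]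
    obtain ⟨v, hv⟩ := (LinearMap.injective_iff_surjective_of_finrank_eq_finrank
      (by simp [hdim z])).1 hinj w
    exact ⟨v, v.2, hv⟩
  have hmem : ∀ z, (M z).det ≠ 0 → ∀ w, (A z).mulVec ((N z).mulVec (s w)) = 0 := by
    intro z hz w
    obtain ⟨v, hv, rfl⟩ := hsurj z hz w
    rw [hleft z hz v hv, hv]
  have hright : ∀ z, (M z).det ≠ 0 → ∀ w, q ((N z).mulVec (s w)) = w := by
    intro z hz w
    obtain ⟨v, hv, rfl⟩ := hsurj z hz w
    rw [hleft z hz v hv]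
  have hs : Continuous s := s.continuous_of_finiteDimensional
  have hq : Continuous q := q.continuous_of_finiteDimensional
  have hN : Continuous (fun z : {z | (M z).det ≠ 0} => N z) := by
    have h1 : Continuous (fun z : {z | (M z).det ≠ 0} => M z) := hM.comp continuous_subtype_val
    exact (h1.matrix_det.inv₀ (fun z => z.2)).smul h1.matrix_adjugate
  refine ⟨{z | (M z).det ≠ 0}, isOpen_ne_fun hM.matrix_det continuous_const, by simp [hM0], ?_⟩
  refine ⟨{ toFun := fun x => ⟨(x.1, (N x.1).mulVec (s x.2)), hmem _ x.1.2 _, x.1.2⟩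
            invFun := fun y => (⟨y.1.1, y.2.2⟩, q y.1.2)
            left_inv := fun x => Prod.ext rfl (hright _ x.1.2 _)
            right_inv := fun y => Subtype.ext (Prod.ext rfl (hleft _ y.2.2 _ y.2.1))
            continuous_toFun := ?_
            continuous_invFun := ?_ }, ?_, ?_⟩
  · refine Continuous.subtype_mk ?_ _
    exact (continuous_subtype_val.comp continuous_fst).prodMk
      ((hN.comp continuous_fst).matrix_mulVec (hs.comp continuous_snd))
  · refine Continuous.prodMk ?_ ?_
    · exact Continuous.subtype_mk (continuous_fst.comp continuous_subtype_val) _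
    · exact hq.comp (continuous_snd.comp continuous_subtype_val)
  · intro z w
    rfl
  · intro z
    refine ⟨((N z).mulVecLin ∘ₗ s).isLinear, ?_, ?_⟩
    · intro a b hab
      have hab' : (N z).mulVec (s a) = (N z).mulVec (s b) := hab
      rw [← hright z z.2 a, hab', hright z z.2 b]
    · intro v hv
      exact ⟨q v, hleft z z.2 v hv⟩
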